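/- arXiv:2311.06063 — 6 statements merged into one kernel-verified Lean document; each statement's English description precedes it below -/
import Mathlib

section
/- Let n ≥ 1, let u ∈ ℝ^n, and let j, k ∈ {1,…,n} with k < j and u_k < u_j. For any ε with 0 < ε < u_j − u_k, let u^ε ∈ ℝ^n be the vector obtained from u by replacing u_j with u_j − ε and u_k with u_k + ε (a Pigou–Dalton transfer of size ε from component j to component k). If the weight vector ω ∈ ℝ^n is nondecreasing, i.e. ω_ℓ ≤ ω_{ℓ+1} for all ℓ ∈ {1,…,n−1}, then OWA(u^ε, ω) ≤ OWA(u, ω). -/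
/-- Ordered weighted average: `Tuple.sort u` sorts the components of `u` nondecreasingly. -/
noncomputable def OWA {n : ℕ} (u ω : Fin n → ℝ) : ℝ :=
  ∑ j : Fin n, ω j * u (Tuple.sort u j)

theorem owa_perm_le {n : ℕ} (u ω : Fin n → ℝ) (hω : Monotone ω) (σ : Equiv.Perm (Fin n)) :
    ∑ i, ω i * u (σ i) ≤ OWA u ω := by
  have h : Monovary ω (u ∘ Tuple.sort u) := hω.monovary (Tuple.monotone_sort u)
  have := h.sum_mul_comp_perm_le_sum_mul (σ := σ.trans (Tuple.sort u).symm)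
  simpa [OWA] using this

/-- Pigou–Dalton transfers decrease the OWA value when the weights are nondecreasing. -/
theorem owa_pigou_dalton {n : ℕ} (hn : 1 ≤ n) (u ω : Fin n → ℝ) (j k : Fin n)
    (hkj : k < j) (hu : u k < u j) (ε : ℝ) (hε0 : 0 < ε) (hε1 : ε < u j - u k)
    (hω : ∀ ℓ : Fin n, ∀ hl : (ℓ : ℕ) + 1 < n, ω ℓ ≤ ω ⟨(ℓ : ℕ) + 1, hl⟩) :
    OWA (Function.update (Function.update u j (u j - ε)) k (u k + ε)) ω ≤ OWA u ω := by
  have hm : Monotone ω := by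
    obtain ⟨m, rfl⟩ : ∃ m, n = m + 1 := ⟨n - 1, by omega⟩
    refine Fin.monotone_iff_le_succ.2 fun i => ?_
    exact hω i.castSucc (by simp)
  have hd : 0 < u j - u k := by linarith
  obtain ⟨t, ht⟩ : ∃ t, t = ε / (u j - u k) := ⟨_, rfl⟩
  have hte : t * (u j - u k) = ε := by rw [ht]; field_simp
  have ht0 : 0 ≤ t := by rw [ht]; positivity
  have ht1 : t ≤ 1 := by rw [ht, div_le_one hd]; exact hε1.le
  have hv : ∀ i, Function.update (Function.update u j (u j - ε)) k (u k + ε) i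
      = (1 - t) * u i + t * u (Equiv.swap j k i) := by
    intro i
    by_cases hik : i = k
    · subst hik
      simp only [Function.update_self, Equiv.swap_apply_right]
      linarith
    · by_cases hij : i = j
      · subst hij
        simp only [Function.update_of_ne hik, Function.update_self, Equiv.swap_apply_left]
        linarith
      · rw [Function.update_of_ne hik, Function.update_of_ne hij,
          Equiv.swap_apply_of_ne_of_ne hij hik]
        ring
  generalize Function.update (Function.update u j (u j - ε)) k (u k + ε) = v at hv
  have h1 := owa_perm_le u ω hm (Tuple.sort v)
  have h2 := owa_perm_le u ω hm ((Tuple.sort v).trans (Equiv.swap j k))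
  simp only [Equiv.trans_apply] at h2
  have h3 : OWA v ω = (1 - t) * ∑ i, ω i * u (Tuple.sort v i)
      + t * ∑ i, ω i * u (Equiv.swap j k (Tuple.sort v i)) := by
    rw [OWA, Finset.mul_sum, Finset.mul_sum, ← Finset.sum_add_distrib]
    refine Finset.sum_congr rfl fun i _ => ?_
    rw [hv (Tuple.sort v i)]
    ring
  rw [h3]
  have h4 := mul_le_mul_of_nonneg_left h1 (sub_nonneg.2 ht1)
  have h5 := mul_le_mul_of_nonneg_left h2 ht0
  linarith
end

section
/- Let ω ∈ ℝ^n be a weight vector with ω_j > 0 for all j ∈ {1,…,n}. If u, v ∈ ℝ^n satisfy u_j ≤ v_j for all j ∈ {1,…,n} and u ≠ v (i.e. u Pareto dominates v as a cost vector), then OWA(u, ω) < OWA(v, ω). -/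
theorem owa_sorted_le {n : ℕ} (u v : Fin n → ℝ) (huv : ∀ j, u j ≤ v j) (j : Fin n) :
    u (Tuple.sort u j) ≤ v (Tuple.sort v j) := by
  obtain ⟨i, hi, hk⟩ : ∃ i ≤ j, j ≤ (Tuple.sort u).symm (Tuple.sort v i) := by
    by_contra! h
    have hsub : (Finset.Iic j).map ((Tuple.sort v).trans (Tuple.sort u).symm).toEmbedding
        ⊆ Finset.Iio j := by
      intro x hx
      rw [Finset.mem_map] at hx
      obtain ⟨i, hi, rfl⟩ := hx
      exact Finset.mem_Iio.2 (h i (Finset.mem_Iic.1 hi))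
    have := Finset.card_le_card hsub
    simp at this
  have h1 := Tuple.monotone_sort u hk
  have h2 := Tuple.monotone_sort v hi
  simp only [Function.comp, Equiv.apply_symm_apply] at h1 h2
  exact h1.trans ((huv _).trans h2)

/-- With positive weights, the OWA operator strictly respects Pareto dominance. -/
theorem owa_strict_pareto {n : ℕ} (ω : Fin n → ℝ) (hω : ∀ j, 0 < ω j)
    (u v : Fin n → ℝ) (huv : ∀ j, u j ≤ v j) (hne : u ≠ v) :
    OWA u ω < OWA v ω := by
  have hle := owa_sorted_le u v huv
  obtain ⟨k, hk⟩ := Function.ne_iff.1 hne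
  have hs : ∑ j, u j < ∑ j, v j :=
    Finset.sum_lt_sum (fun i _ => huv i) ⟨k, Finset.mem_univ _, lt_of_le_of_ne (huv k) hk⟩
  rw [← Equiv.sum_comp (Tuple.sort u) u, ← Equiv.sum_comp (Tuple.sort v) v] at hs
  obtain ⟨j, hj, hlt⟩ := Finset.exists_lt_of_sum_lt hs
  exact Finset.sum_lt_sum (fun i _ => mul_le_mul_of_nonneg_left (hle i) (hω i).le)
    ⟨j, hj, mul_lt_mul_of_pos_left hlt (hω j)⟩
end

section
/- Let X ⊆ ℝ^n be a finite nonempty set of cost vectors and let ω ∈ ℝ^n be a weight vector with ω_j > 0 for all j ∈ {1,…,n}. If u ∈ X attains the minimum of OWA(·, ω) over X, then u is Pareto-optimal in X, i.e. there is no v ∈ X with v ≠ u and v_j ≤ u_j for all j ∈ {1,…,n}. -/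
theorem sort_le_sort_aux {n : ℕ} (u v : Fin n → ℝ) (h : ∀ j, v j ≤ u j) (j : Fin n) :
    v (Tuple.sort v j) ≤ u (Tuple.sort u j) := by
  have key : ¬ Disjoint ((Finset.Iic j).map (Tuple.sort u).toEmbedding)
      ((Finset.Ici j).map (Tuple.sort v).toEmbedding) := by
    intro hd
    have h1 := Finset.card_union_of_disjoint hd
    have h2 := Finset.card_le_univ (((Finset.Iic j).map (Tuple.sort u).toEmbedding) ∪
      ((Finset.Ici j).map (Tuple.sort v).toEmbedding))
    rw [h1, Finset.card_map, Finset.card_map, Fin.card_Iic, Fin.card_Ici, Fintype.card_fin] at h2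
    have := j.isLt
    omega
  obtain ⟨k, hk1, hk2⟩ := Finset.not_disjoint_iff.1 key
  obtain ⟨a, ha, rfl⟩ := Finset.mem_map.1 hk1
  obtain ⟨b, hb, hab⟩ := Finset.mem_map.1 hk2
  have h1 : u (Tuple.sort u a) ≤ u (Tuple.sort u j) :=
    Tuple.monotone_sort u (Finset.mem_Iic.1 ha)
  have h2 : v (Tuple.sort v j) ≤ v (Tuple.sort v b) :=
    Tuple.monotone_sort v (Finset.mem_Ici.1 hb)
  have hab' : Tuple.sort v b = Tuple.sort u a := hab
  rw [hab'] at h2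
  exact h2.trans ((h _).trans h1)

/-- Any OWA-minimizer (with positive weights) over a finite nonempty set of cost vectors
is Pareto-optimal in that set. -/
theorem owa_minimizer_pareto_optimal {n : ℕ} (X : Finset (Fin n → ℝ)) (hX : X.Nonempty)
    (ω : Fin n → ℝ) (hω : ∀ j, 0 < ω j) (u : Fin n → ℝ) (hu : u ∈ X)
    (hopt : ∀ v ∈ X, OWA u ω ≤ OWA v ω) :
    ¬ ∃ v ∈ X, v ≠ u ∧ ∀ j, v j ≤ u j := by
  rintro ⟨v, hv, hne, hle⟩
  have hs := sort_le_sort_aux u v hle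
  obtain ⟨k, hk⟩ : ∃ k, v k ≠ u k := Function.ne_iff.1 hne
  have hsum : ∑ j, v j < ∑ j, u j :=
    Finset.sum_lt_sum (fun j _ => hle j) ⟨k, Finset.mem_univ _, lt_of_le_of_ne (hle k) hk⟩
  rw [← Equiv.sum_comp (Tuple.sort v) v, ← Equiv.sum_comp (Tuple.sort u) u] at hsum
  obtain ⟨j, hj, hlt⟩ := Finset.exists_lt_of_sum_lt hsum
  refine absurd (hopt v hv) (not_le.2 ?_)
  unfold OWA
  exact Finset.sum_lt_sum (fun j _ => mul_le_mul_of_nonneg_left (hs j) (hω j).le)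
    ⟨j, hj, mul_lt_mul_of_pos_left hlt (hω j)⟩
end

section
/- Let N be a finite set and let m : 2^N → ℝ be a set function with m(A) ≥ 0 for all A ⊆ N. Then the set function ω defined by ω(A) = ∑_{B ⊆ A} m(B) is supermodular (convex), i.e. ω(A ∪ B) + ω(A ∩ B) ≥ ω(A) + ω(B) for all A, B ⊆ N. (Capacities whose Möbius masses are nonnegative, a.k.a. belief functions, are necessarily convex.) -/
/-- A set function with nonnegative Möbius masses (a belief function) is
supermodular (convex). -/
theorem belief_function_supermodular {N : Type*} [Fintype N] [DecidableEq N]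
    (m : Finset N → ℝ) (hm : ∀ A : Finset N, 0 ≤ m A)
    (ω : Finset N → ℝ) (hω : ∀ A : Finset N, ω A = ∑ B ∈ A.powerset, m B) :
    ∀ A B : Finset N, ω A + ω B ≤ ω (A ∪ B) + ω (A ∩ B) := by
  intro A B
  have hi : (A ∩ B).powerset = A.powerset ∩ B.powerset := by
    ext C
    simp only [Finset.mem_powerset, Finset.mem_inter, Finset.subset_inter_iff]
  rw [hω, hω, hω, hω, hi, ← Finset.sum_union_inter]
  gcongr
  · intro i _ _
    exact hm i
  · apply Finset.union_subset
    · exact Finset.powerset_mono.2 Finset.subset_union_left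
    · exact Finset.powerset_mono.2 Finset.subset_union_right
end

section
/- Let ω be a capacity on N = {1,…,n} and let m be its Möbius inverse, m(A) = ∑_{B ⊆ A} (−1)^{|A∖B|} ω(B). Then for every u ∈ ℝ^n with u_j ≥ 0 for all j, Choquet(u, ω) = ∑_{∅ ≠ A ⊆ N} m(A) · min_{j ∈ A} u_j. -/
/-- The Choquet integral of the (componentwise nonnegative) cost vector `u` w.r.t. the
set function `ω`, using the sorting permutation `Tuple.sort u`. -/
noncomputable def Choquet {n : ℕ} (u : Fin n → ℝ) (ω : Finset (Fin n) → ℝ) : ℝ :=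
  ∑ j : Fin n,
    (u (Tuple.sort u j) -
      if 0 < (j : ℕ) then
        u (Tuple.sort u ⟨(j : ℕ) - 1, lt_of_le_of_lt (Nat.sub_le _ _) j.isLt⟩)
      else 0) *
    ω ((Finset.univ.filter fun i : Fin n => j ≤ i).image (Tuple.sort u))

/-- A (normalized) capacity on `{1,…,n}`. -/
def IsCapacity {n : ℕ} (ω : Finset (Fin n) → ℝ) : Prop :=
  ω ∅ = 0 ∧ ω Finset.univ = 1 ∧ ∀ A B : Finset (Fin n), A ⊆ B → ω A ≤ ω B

theorem aux_moebius {n : ℕ} (ω m : Finset (Fin n) → ℝ)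
    (hm : ∀ A : Finset (Fin n), m A = ∑ B ∈ A.powerset, (-1 : ℝ) ^ (A \ B).card * ω B)
    (S : Finset (Fin n)) : ∑ A ∈ S.powerset, m A = ω S := by
  simp_rw [hm]
  rw [Finset.sum_comm' (t' := S.powerset) (s' := fun B => Finset.Icc B S)]
  · have key : ∀ B ∈ S.powerset, ∑ A ∈ Finset.Icc B S, (-1 : ℝ) ^ (A \ B).card * ω B
        = if B = S then ω S else 0 := by
      intro B hB
      have hBS := Finset.mem_powerset.mp hB
      rw [← Finset.sum_mul, Finset.Icc_eq_image_powerset hBS, Finset.sum_image]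
      · have h1 : ∑ x ∈ (S \ B).powerset, (-1 : ℝ) ^ ((B ∪ x) \ B).card
            = ∑ x ∈ (S \ B).powerset, (-1 : ℝ) ^ x.card := by
          refine Finset.sum_congr rfl fun x hx => ?_
          have hx := Finset.mem_powerset.mp hx
          have : (B ∪ x) \ B = x := by
            ext a
            have := @hx a
            simp only [Finset.mem_sdiff, Finset.mem_union] at *
            tauto
          rw [this]
        rw [h1]
        have h2 := @Finset.sum_powerset_neg_one_pow_card _ _ (S \ B)
        have h3 : ∑ x ∈ (S \ B).powerset, (-1 : ℝ) ^ x.card = if S \ B = ∅ then 1 else 0 := by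
          exact_mod_cast congrArg (Int.cast : ℤ → ℝ) h2
        rw [h3]
        by_cases h : B = S
        · simp [h]
        · have : ¬ (S \ B = ∅) := by
            rw [Finset.sdiff_eq_empty_iff_subset]
            exact fun h' => h (hBS.antisymm h')
          simp [h, this]
      · intro x hx y hy hxy
        have hx := Finset.mem_powerset.mp hx
        have hy := Finset.mem_powerset.mp hy
        ext a
        have h1 := @hx a
        have h2 := @hy a
        have h3 := Finset.ext_iff.mp hxy a
        simp only [Finset.mem_sdiff, Finset.mem_union] at *
        tauto
    rw [Finset.sum_congr rfl key]
    simp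
  · intro A B
    simp only [Finset.mem_powerset, Finset.mem_Icc]
    exact ⟨fun h => ⟨⟨h.2, h.1⟩, h.2.trans h.1⟩, fun h => ⟨h.1.2, h.1.1⟩⟩

theorem aux_tele {n : ℕ} (v : Fin n → ℝ) (k : ℕ) (hk : k < n) :
    ∑ j : Fin n, (if j ≤ ⟨k, hk⟩ then (v j - if 0 < (j : ℕ) then
        v ⟨(j : ℕ) - 1, lt_of_le_of_lt (Nat.sub_le _ _) j.isLt⟩ else 0) else 0) = v ⟨k, hk⟩ := by
  induction k with
  | zero =>
    rw [Finset.sum_eq_single ⟨0, hk⟩]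
    · simp
    · intro b _ hb
      rw [if_neg]
      intro h
      exact hb (Fin.ext (by simpa [Fin.le_def] using h))
    · simp
  | succ k ih =>
    have ih := ih (by omega)
    have hs : ∀ j : Fin n, (if j ≤ ⟨k+1, hk⟩ then (v j - if 0 < (j : ℕ) then
        v ⟨(j : ℕ) - 1, lt_of_le_of_lt (Nat.sub_le _ _) j.isLt⟩ else 0) else 0)
        = (if j ≤ ⟨k, by omega⟩ then (v j - if 0 < (j : ℕ) then
        v ⟨(j : ℕ) - 1, lt_of_le_of_lt (Nat.sub_le _ _) j.isLt⟩ else 0) else 0)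
        + (if j = ⟨k+1, hk⟩ then v ⟨k+1, hk⟩ - v ⟨k, by omega⟩ else 0) := by
      intro j
      by_cases h : j = ⟨k+1, hk⟩
      · subst h
        simp [Fin.le_def]
      · have h' : (j : ℕ) ≠ k + 1 := fun e => h (Fin.ext e)
        have : j ≤ ⟨k+1, hk⟩ ↔ j ≤ ⟨k, by omega⟩ := by
          simp only [Fin.le_def]; omega
        simp only [this, h, if_false, add_zero]
    rw [Finset.sum_congr rfl fun j _ => hs j, Finset.sum_add_distrib, ih]
    simp

theorem aux_inf {n : ℕ} (u : Fin n → ℝ) (A : Finset (Fin n)) (hA : A.Nonempty) :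
    ∑ j : Fin n, (if A ⊆ ((Finset.univ.filter fun i : Fin n => j ≤ i).image (Tuple.sort u)) then
      (u (Tuple.sort u j) -
      if 0 < (j : ℕ) then
        u (Tuple.sort u ⟨(j : ℕ) - 1, lt_of_le_of_lt (Nat.sub_le _ _) j.isLt⟩)
      else 0) else 0) = A.inf' hA u := by
  have hmono : Monotone (u ∘ Tuple.sort u) := Tuple.monotone_sort u
  obtain ⟨a, haA, ha⟩ := A.exists_min_image (fun i => (Tuple.sort u).symm i) hA
  have hiff : ∀ j, A ⊆ ((Finset.univ.filter fun i : Fin n => j ≤ i).image (Tuple.sort u)) ↔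
      j ≤ (Tuple.sort u).symm a := by
    intro j
    constructor
    · intro h
      obtain ⟨i, hi, e⟩ := Finset.mem_image.mp (h haA)
      rw [← e]
      simpa using hi
    · intro h b hb
      exact Finset.mem_image.mpr ⟨(Tuple.sort u).symm b, by simpa using h.trans (ha b hb), by simp⟩
  simp only [hiff]
  have := aux_tele (u ∘ Tuple.sort u) _ ((Tuple.sort u).symm a).isLt
  simp only [Function.comp, Fin.eta, Equiv.apply_symm_apply] at this
  rw [this]
  apply le_antisymm
  · refine Finset.le_inf' _ _ fun b hb => ?_
    simpa using hmono (ha b hb)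
  · exact Finset.inf'_le _ haA

/-- The Choquet integral as a weighted sum of minima, weighted by the Möbius masses:
`Choquet(u, ω) = ∑_{∅ ≠ A ⊆ N} m(A) · min_{j ∈ A} u j`. -/
theorem choquet_moebius_formula {n : ℕ} (ω : Finset (Fin n) → ℝ) (hω : IsCapacity ω)
    (m : Finset (Fin n) → ℝ)
    (hm : ∀ A : Finset (Fin n), m A = ∑ B ∈ A.powerset, (-1 : ℝ) ^ (A \ B).card * ω B)
    (u : Fin n → ℝ) (hu : ∀ j, 0 ≤ u j) :
    Choquet u ω =
      ∑ A ∈ ((Finset.univ : Finset (Finset (Fin n))).filter Finset.Nonempty).attach,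
        m A.1 * A.1.inf' ((Finset.mem_filter.mp A.2).2) u := by
  have hm0 : m ∅ = 0 := by rw [hm]; simp [hω.1]
  obtain ⟨g, hg⟩ : ∃ g : Finset (Fin n) → ℝ, ∀ A, g A = m A *
      ∑ j : Fin n, (if A ⊆ ((Finset.univ.filter fun i : Fin n => j ≤ i).image (Tuple.sort u)) then
      (u (Tuple.sort u j) -
      if 0 < (j : ℕ) then
        u (Tuple.sort u ⟨(j : ℕ) - 1, lt_of_le_of_lt (Nat.sub_le _ _) j.isLt⟩)
      else 0) else 0) := ⟨_, fun _ => rfl⟩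
  have hR : ∀ A ∈ ((Finset.univ : Finset (Finset (Fin n))).filter Finset.Nonempty).attach,
      m A.1 * A.1.inf' ((Finset.mem_filter.mp A.2).2) u = g A.1 := by
    intro A _
    rw [hg, aux_inf u A.1 (Finset.mem_filter.mp A.2).2]
  rw [Finset.sum_congr rfl hR, Finset.sum_attach _ g, Finset.sum_filter_of_ne]
  · unfold Choquet
    simp_rw [hg, Finset.mul_sum]
    rw [Finset.sum_comm]
    refine Finset.sum_congr rfl fun j _ => ?_
    rw [← aux_moebius ω m hm, Finset.mul_sum]
    simp only [mul_ite, mul_zero]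
    rw [← Finset.sum_filter]
    refine Finset.sum_congr (by ext; simp) fun A _ => mul_comm _ _
  · intro A _ h
    rw [Finset.nonempty_iff_ne_empty]
    rintro rfl
    exact h (by rw [hg, hm0, zero_mul])
end

section
/- Let ω be a submodular (concave) capacity on N = {1,…,n}, i.e. ω(A ∪ B) + ω(A ∩ B) ≤ ω(A) + ω(B) for all A, B ⊆ N. Then the Choquet integral is a convex function on the nonnegative orthant: for all u, v ∈ ℝ^n with nonnegative components and all λ ∈ [0,1], Choquet(λu + (1−λ)v, ω) ≤ λ·Choquet(u, ω) + (1−λ)·Choquet(v, ω). -/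
lemma choq_telescope {n : ℕ} (f : Fin n → ℝ) : ∀ (m : ℕ) (hm : m < n),
    ∑ j : Fin n, (if (j : ℕ) ≤ m then (f j - if 0 < (j : ℕ) then
        f ⟨(j : ℕ) - 1, lt_of_le_of_lt (Nat.sub_le _ _) j.isLt⟩ else 0) else 0) = f ⟨m, hm⟩ := by
  intro m
  induction m with
  | zero =>
    intro hm
    rw [Finset.sum_eq_single (⟨0, hm⟩ : Fin n)]
    · simp
    · intro b _ hb
      have : ¬ ((b : ℕ) ≤ 0) := fun h => hb (Fin.ext (by simpa using h))
      simp only [this, if_false]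
    · simp
  | succ m ih =>
    intro hm
    have h1 := ih (by omega)
    have h2 : ∑ j : Fin n, (if j = ⟨m+1, hm⟩ then (f j - if 0 < (j : ℕ) then
        f ⟨(j : ℕ) - 1, lt_of_le_of_lt (Nat.sub_le _ _) j.isLt⟩ else 0) else 0)
        = f ⟨m+1, hm⟩ - f ⟨m, by omega⟩ := by
      rw [Finset.sum_ite_eq']
      simp
    have h3 : f ⟨m+1, hm⟩ = f ⟨m, by omega⟩ + (f ⟨m+1, hm⟩ - f ⟨m, by omega⟩) := by ring
    rw [h3, ← h2, ← h1, ← Finset.sum_add_distrib]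
    refine Finset.sum_congr rfl fun j _ => ?_
    by_cases ha : (j : ℕ) ≤ m
    · have : j ≠ ⟨m+1, hm⟩ := fun h => by rw [h] at ha; simp at ha
      simp only [ha, this, if_true, if_false, Nat.le_succ_of_le ha, add_zero]
    · by_cases hb : j = ⟨m+1, hm⟩
      · subst hb
        simp
      · have : ¬ ((j : ℕ) ≤ m + 1) := fun h => hb (Fin.ext (by simp; omega))
        simp only [ha, hb, this, if_false, add_zero]

lemma choq_additive {n : ℕ} (u p : Fin n → ℝ) :
    Choquet u (fun A => ∑ i ∈ A, p i) = ∑ i, u i * p i := by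
  unfold Choquet
  set σ := Tuple.sort u with hσ
  rw [← Equiv.sum_comp σ (fun i => u i * p i)]
  have := fun i : Fin n => choq_telescope (fun k => u (σ k)) i i.isLt
  simp only [Fin.eta] at this
  calc _ = ∑ j : Fin n, ∑ i : Fin n, (if (j : ℕ) ≤ i then (u (σ j) - if 0 < (j : ℕ) then
        u (σ ⟨(j : ℕ) - 1, lt_of_le_of_lt (Nat.sub_le _ _) j.isLt⟩) else 0) else 0) * p (σ i) := by
        refine Finset.sum_congr rfl fun j _ => ?_
        dsimp only
        rw [Finset.sum_image (fun a _ b _ h => σ.injective h), Finset.mul_sum, Finset.sum_filter]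
        refine Finset.sum_congr rfl fun i _ => ?_
        by_cases h : j ≤ i
        · simp only [h, if_true, Fin.val_fin_le]
        · simp only [h, if_false, Fin.val_fin_le, zero_mul]
    _ = _ := by
        rw [Finset.sum_comm]
        refine Finset.sum_congr rfl fun i _ => ?_
        rw [← Finset.sum_mul, this i]

lemma choq_mono {n : ℕ} (u : Fin n → ℝ) (hu : ∀ j, 0 ≤ u j) (a b : Finset (Fin n) → ℝ)
    (h : ∀ A, a A ≤ b A) : Choquet u a ≤ Choquet u b := by
  unfold Choquet
  refine Finset.sum_le_sum fun j _ => mul_le_mul_of_nonneg_left (h _) ?_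
  split_ifs with hj
  · rw [sub_nonneg]
    exact Tuple.monotone_sort u (Fin.le_def.2 (Nat.sub_le _ _))
  · simpa using hu _

lemma choq_core {n : ℕ} (ω : Finset (Fin n) → ℝ) (h0 : ω ∅ = 0)
    (hsub : ∀ A B : Finset (Fin n), ω (A ∪ B) + ω (A ∩ B) ≤ ω A + ω B)
    (σ : Equiv.Perm (Fin n)) : ∃ p : Fin n → ℝ, (∀ A, ∑ i ∈ A, p i ≤ ω A) ∧
      ∀ j : Fin n, ∑ i ∈ (Finset.univ.filter fun i : Fin n => j ≤ i).image σ, p i =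
        ω ((Finset.univ.filter fun i : Fin n => j ≤ i).image σ) := by
  let T : ℕ → Finset (Fin n) := fun k => Finset.univ.filter fun i => k ≤ (σ.symm i : ℕ)
  let p : Fin n → ℝ := fun i => ω (T (σ.symm i)) - ω (T (σ.symm i + 1))
  have hmem : ∀ k i, i ∈ T k ↔ k ≤ (σ.symm i : ℕ) := fun k i => by simp [T]
  have hTn : T n = ∅ := by
    ext i; simp [hmem]
  have hT : ∀ k (hk : k < n), T k = insert (σ ⟨k, hk⟩) (T (k+1)) := by
    intro k hk
    ext i
    rw [Finset.mem_insert, hmem, hmem, ← Equiv.symm_apply_eq, Fin.ext_iff]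
    dsimp only
    omega
  have hnot : ∀ k (hk : k < n), σ ⟨k, hk⟩ ∉ T (k+1) := by
    intro k hk; simp [hmem]
  have hp : ∀ k (hk : k < n), p (σ ⟨k, hk⟩) = ω (T k) - ω (T (k+1)) := by
    intro k hk; simp [p]
  have key : ∀ d k, k + d = n → (∀ A, ∑ i ∈ A ∩ T k, p i ≤ ω (A ∩ T k)) ∧
      ∑ i ∈ T k, p i = ω (T k) := by
    intro d
    induction d with
    | zero =>
      intro k hk
      obtain rfl : k = n := by omega
      simp [hTn, h0]
    | succ d ih =>
      intro k hk
      have hkn : k < n := by omega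
      obtain ⟨i1, i2⟩ := ih (k+1) (by omega)
      constructor
      · intro A
        have h1 := i1 A
        by_cases hA : σ ⟨k, hkn⟩ ∈ A
        · have e : A ∩ T k = insert (σ ⟨k, hkn⟩) (A ∩ T (k+1)) := by
            rw [hT k hkn, Finset.inter_insert_of_mem hA]
          have s := hsub (A ∩ T k) (T (k+1))
          have e1 : (A ∩ T k) ∪ T (k+1) = T k := by
            rw [hT k hkn]; ext i; simp only [Finset.mem_union, Finset.mem_inter, Finset.mem_insert]
            constructor
            · tauto
            · rintro (rfl | h) <;> tauto
          have e2 : (A ∩ T k) ∩ T (k+1) = A ∩ T (k+1) := by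
            rw [hT k hkn]; ext i; simp only [Finset.mem_inter, Finset.mem_insert]; tauto
          rw [e1, e2] at s
          have e3 : ∑ i ∈ A ∩ T k, p i = p (σ ⟨k, hkn⟩) + ∑ i ∈ A ∩ T (k+1), p i := by
            rw [e, Finset.sum_insert]
            exact fun h => hnot k hkn (Finset.mem_inter.1 h).2
          rw [e3, hp]
          linarith
        · rw [hT k hkn, Finset.inter_insert_of_notMem hA]
          exact h1
      · have e3 : ∑ i ∈ T k, p i = p (σ ⟨k, hkn⟩) + ∑ i ∈ T (k+1), p i := by
          rw [hT k hkn, Finset.sum_insert (hnot k hkn)]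
        rw [e3, hp, i2]; ring
  refine ⟨p, fun A => ?_, fun j => ?_⟩
  · have h := (key n 0 (by omega)).1 A
    have : T 0 = Finset.univ := by ext i; simp [hmem]
    simpa [this] using h
  · have e : (Finset.univ.filter fun i : Fin n => j ≤ i).image σ = T j := by
      ext i
      rw [hmem]
      simp only [Finset.mem_image, Finset.mem_filter, Finset.mem_univ, true_and]
      constructor
      · rintro ⟨a, ha, rfl⟩; simpa using ha
      · intro h; exact ⟨σ.symm i, h, by simp⟩
    rw [e]
    exact (key (n - j) j (by omega)).2

/-- The Choquet integral w.r.t. a submodular (concave) capacity is a convex function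
on the nonnegative orthant. -/
theorem choquet_submodular_convex {n : ℕ} (ω : Finset (Fin n) → ℝ) (hω : IsCapacity ω)
    (hsub : ∀ A B : Finset (Fin n), ω (A ∪ B) + ω (A ∩ B) ≤ ω A + ω B)
    (u v : Fin n → ℝ) (hu : ∀ j, 0 ≤ u j) (hv : ∀ j, 0 ≤ v j)
    (l : ℝ) (hl0 : 0 ≤ l) (hl1 : l ≤ 1) :
    Choquet (fun j => l * u j + (1 - l) * v j) ω ≤
      l * Choquet u ω + (1 - l) * Choquet v ω := by
  obtain ⟨p, hp1, hp2⟩ := choq_core ω hω.1 hsub (Tuple.sort (fun j => l * u j + (1 - l) * v j))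
  have h1 : Choquet (fun j => l * u j + (1 - l) * v j) ω =
      Choquet (fun j => l * u j + (1 - l) * v j) (fun A => ∑ i ∈ A, p i) := by
    unfold Choquet
    refine Finset.sum_congr rfl fun j _ => ?_
    dsimp only
    rw [hp2 j]
  have h2 := choq_mono u hu _ _ hp1
  have h3 := choq_mono v hv _ _ hp1
  rw [choq_additive] at h1 h2 h3
  rw [h1]
  calc _ = l * ∑ i, u i * p i + (1 - l) * ∑ i, v i * p i := by
        rw [Finset.mul_sum, Finset.mul_sum, ← Finset.sum_add_distrib]
        exact Finset.sum_congr rfl fun i _ => by ring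
    _ ≤ _ := add_le_add (mul_le_mul_of_nonneg_left h2 hl0)
        (mul_le_mul_of_nonneg_left h3 (by linarith))
end
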